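/- arXiv:math/0607519 — 4 statements merged into one kernel-verified Lean document; each statement's English description precedes it below -/
import Mathlib

section
/- For every l ≥ 1, the matrix M_{l,l+1} admits the block decomposition M_{l,l+1} = P + Q, where P is the m(l) × m(l+1) matrix whose first m(l−1) rows form S_l and whose last m(l−2) rows form [S_{l−1} | 0] (an m(l−2) × m(l+1) matrix with zero last m(l−1) columns), and Q is the m(l) × m(l+1) matrix whose first m(l) columns form the m(l) × m(l) identity matrix and whose last m(l−1) columns have Q(i, m(l)+i) = 1 for 1 ≤ i ≤ m(l−1) and all other entries 0. -/
noncomputable section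



open Finset

/-- Admissibility for the golden-mean (Fibonacci) shift: words over the alphabet
`{1,2}` (coded as `Fin 2`, where `0` codes the letter `1` and `1` codes the letter `2`)
with no two consecutive letters equal to `2`. -/
def DyckAdm (l : ℕ) (w : Fin l → Fin 2) : Prop :=
  ∀ i j : Fin l, (j : ℕ) = (i : ℕ) + 1 → ¬(w i = 1 ∧ w j = 1)

instance (l : ℕ) : DecidablePred (DyckAdm l) := fun w => by
  unfold DyckAdm; infer_instance

/-- The set `W_l` of admissible words of length `l`. -/
def Wset (l : ℕ) : Finset (Fin l → Fin 2) := univ.filter (DyckAdm l)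

/-- `m(l)`, the number of admissible words of length `l`. -/
def mW (l : ℕ) : ℕ := (Wset l).card

/-- Lexicographic (from the left) strict order on words. -/
def lexLt (l : ℕ) (u w : Fin l → Fin 2) : Prop :=
  ∃ i : Fin l, (∀ j : Fin l, j < i → u j = w j) ∧ u i < w i

instance (l : ℕ) : DecidableRel (lexLt l) := fun u w => by
  unfold lexLt; infer_instance

/-- The (1-based) position of an admissible word in the lexicographic ordering of `W_l`,
identifying `W_l` with `{1, …, m(l)}`. -/
def rankW (l : ℕ) (w : Fin l → Fin 2) : ℕ :=
  1 + ((Wset l).filter (fun u => lexLt l u w)).card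

/-- The matrix `I_{l,l+1}` (1-based indices, entries outside `{1,…,m(l)} × {1,…,m(l+1)}`
are `0`): `I_{l,l+1}(w,w') = 1` iff the word `w'` with its last letter deleted is `w`. -/
def Imat (l : ℕ) : ℕ → ℕ → ℤ := fun i j =>
  if ∃ w ∈ Wset l, ∃ w' ∈ Wset (l + 1),
      rankW l w = i ∧ rankW (l + 1) w' = j ∧ (∀ k : Fin l, w k = w' k.castSucc)
  then 1 else 0

/-- The matrix `M_{l,l+1}` (1-based indices):
`M_{l,l+1}(w,w') = |{k ∈ {1,2} : w' = k·w}| + ε(w,w')`, where `ε(w,w') = 1` iff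
`F(w_1,w'_1) = 1` and `(w_2,…,w_l) = (w'_1,…,w'_{l-1})`; `M_{0,1} = [3 2]`.
(Here `F(a,b) = 0` iff both letters are `2`, i.e. both codes are `1`.) -/
def Mmat : ℕ → ℕ → ℕ → ℤ
  | 0, i, j => if i = 1 ∧ j = 1 then 3 else if i = 1 ∧ j = 2 then 2 else 0
  | (l + 1), i, j =>
      ∑ w ∈ Wset (l + 1), ∑ w' ∈ Wset (l + 2),
        if rankW (l + 1) w = i ∧ rankW (l + 2) w' = j then
          ((if (∀ t : Fin (l + 1), w' t.succ = w t) then (1 : ℤ) else 0) +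
           (if (¬(w 0 = 1 ∧ w' 0 = 1)) ∧
               (∀ t : Fin (l + 1), (t : ℕ) ≠ 0 →
                 w t = w' ⟨(t : ℕ) - 1,
                   (Nat.sub_le _ _).trans_lt (t.isLt.trans (Nat.lt_succ_self _))⟩)
            then (1 : ℤ) else 0))
        else 0

/-- The matrices `S_l` (of size `m(l-1) × m(l+1)`, 1-based indices):
`S_0 = [1 1]`, `S_1 = [1 1 1]`, `S_{l+2} = [[S_{l+1}, 0], [0, S_l]]` (block diagonal). -/
def Smat : ℕ → ℕ → ℕ → ℤ
  | 0, i, j => if i = 1 ∧ (1 ≤ j ∧ j ≤ 2) then 1 else 0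
  | 1, i, j => if i = 1 ∧ (1 ≤ j ∧ j ≤ 3) then 1 else 0
  | (l + 2), i, j =>
      if i ≤ mW l then (if j ≤ mW (l + 2) then Smat (l + 1) i j else 0)
      else (if j ≤ mW (l + 2) then 0 else Smat l (i - mW l) (j - mW (l + 2)))

theorem mem_Wset {l : ℕ} {w : Fin l → Fin 2} : w ∈ Wset l ↔ DyckAdm l w := by
  simp [Wset]

theorem dyckAdm_cons {l : ℕ} (a : Fin 2) (v : Fin l → Fin 2) :
    DyckAdm (l + 1) (Fin.cons a v : Fin (l + 1) → Fin 2) ↔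
      DyckAdm l v ∧ ∀ t : Fin l, (t : ℕ) = 0 → ¬(a = 1 ∧ v t = 1) := by
  constructor
  · intro h
    refine ⟨fun i j hij => ?_, fun t ht => ?_⟩
    · simpa using h i.succ j.succ (by simpa using hij)
    · simpa using h 0 t.succ (by simpa using ht)
  · rintro ⟨h, h0⟩ i j hij
    induction j using Fin.cases with
    | zero => simp at hij
    | succ j =>
      induction i using Fin.cases with
      | zero => simpa using h0 j (by simpa using hij)
      | succ i => simpa using h i j (by simpa using hij)

theorem lexLt_cons {l : ℕ} (a b : Fin 2) (u v : Fin l → Fin 2) :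
    lexLt (l + 1) (Fin.cons a u : Fin (l + 1) → Fin 2) (Fin.cons b v : Fin (l + 1) → Fin 2) ↔
      a < b ∨ a = b ∧ lexLt l u v := by
  constructor
  · rintro ⟨i, h, hi⟩
    induction i using Fin.cases with
    | zero => exact Or.inl (by simpa using hi)
    | succ i =>
      refine Or.inr ⟨by simpa using h 0 (Fin.succ_pos i), i, fun j hj => ?_, by simpa using hi⟩
      simpa using h j.succ (by simpa using hj)
  · rintro (h | ⟨rfl, i, h, hi⟩)
    · exact ⟨0, fun j hj => absurd hj (Fin.not_lt_zero j), by simpa using h⟩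
    · refine ⟨i.succ, fun j hj => ?_, by simpa using hi⟩
      induction j using Fin.cases with
      | zero => rfl
      | succ j => simpa using h j (by simpa using hj)

theorem zero_cons_mem_Wset {l : ℕ} {v : Fin l → Fin 2} :
    (Fin.cons 0 v : Fin (l + 1) → Fin 2) ∈ Wset (l + 1) ↔ v ∈ Wset l := by
  simp [mem_Wset, dyckAdm_cons]

/-- A nonempty word that may follow the letter `2` starts with the letter `1`. -/
theorem exists_zero_cons_of_one_cons_mem {l : ℕ} {v : Fin (l + 1) → Fin 2}
    (h : (Fin.cons 1 v : Fin (l + 2) → Fin 2) ∈ Wset (l + 2)) :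
    ∃ x ∈ Wset l, v = Fin.cons 0 x := by
  rw [mem_Wset, dyckAdm_cons] at h
  obtain ⟨hv, h0⟩ := h
  have hz : v 0 = 0 := by
    have := h0 0 rfl
    generalize v 0 = a at this
    fin_cases a <;> simp_all
  have hc : v = Fin.cons 0 (Fin.tail v) := by rw [← hz, Fin.cons_self_tail]
  refine ⟨Fin.tail v, ?_, hc⟩
  rw [← zero_cons_mem_Wset, ← hc, mem_Wset]
  exact hv

theorem mem_of_one_cons_mem {l : ℕ} {v : Fin l → Fin 2}
    (h : (Fin.cons 1 v : Fin (l + 1) → Fin 2) ∈ Wset (l + 1)) : v ∈ Wset l :=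
  mem_Wset.2 ((dyckAdm_cons _ _).1 (mem_Wset.1 h)).1

theorem Wset_succ_cases {l : ℕ} {w : Fin (l + 1) → Fin 2} (h : w ∈ Wset (l + 1)) :
    (∃ v ∈ Wset l, w = Fin.cons 0 v) ∨
      ∃ v ∈ Wset l, w = Fin.cons 1 v ∧ (Fin.cons 1 v : Fin (l + 1) → Fin 2) ∈ Wset (l + 1) := by
  induction w using Fin.consCases with
  | _ a v =>
    fin_cases a
    · exact Or.inl ⟨v, zero_cons_mem_Wset.1 h, rfl⟩
    · exact Or.inr ⟨v, mem_of_one_cons_mem h, rfl, h⟩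

theorem cons_injective {l : ℕ} (a : Fin 2) :
    Function.Injective (fun v : Fin l → Fin 2 => (Fin.cons a v : Fin (l + 1) → Fin 2)) :=
  Fin.cons_right_injective (α := fun _ => Fin 2) a

theorem rankW_zero_cons {l : ℕ} (v : Fin l → Fin 2) :
    rankW (l + 1) (Fin.cons 0 v) = rankW l v := by
  unfold rankW
  rw [← card_image_of_injective ((Wset l).filter fun u => lexLt l u v) (cons_injective 0)]
  refine congrArg (fun s => 1 + card s) ?_
  ext u
  simp only [mem_filter, mem_image]
  constructor
  · rintro ⟨hu, hlt⟩
    obtain ⟨x, hx, rfl⟩ | ⟨x, hx, rfl, -⟩ := Wset_succ_cases hu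
    · exact ⟨x, ⟨hx, by simpa [lexLt_cons] using hlt⟩, rfl⟩
    · simp [lexLt_cons] at hlt
  · rintro ⟨x, ⟨hx, hlt⟩, rfl⟩
    exact ⟨zero_cons_mem_Wset.2 hx, by simpa [lexLt_cons] using hlt⟩

/-- Smaller words may follow `2` whenever larger ones may. -/
theorem one_cons_mem_of_lexLt {l : ℕ} {u v : Fin l → Fin 2} (hu : u ∈ Wset l)
    (hv : (Fin.cons 1 v : Fin (l + 1) → Fin 2) ∈ Wset (l + 1)) (h : lexLt l u v) :
    (Fin.cons 1 u : Fin (l + 1) → Fin 2) ∈ Wset (l + 1) := by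
  cases l with
  | zero => exact h.choose.elim0
  | succ l =>
    obtain ⟨x, hx, rfl⟩ := exists_zero_cons_of_one_cons_mem hv
    obtain ⟨y, hy, rfl⟩ | ⟨y, hy, rfl, -⟩ := Wset_succ_cases hu
    · rw [mem_Wset, dyckAdm_cons]
      refine ⟨mem_Wset.1 hu, fun t ht => ?_⟩
      obtain rfl : t = 0 := Fin.ext ht
      simp
    · simp [lexLt_cons] at h

theorem rankW_one_cons {l : ℕ} {v : Fin l → Fin 2}
    (hv : (Fin.cons 1 v : Fin (l + 1) → Fin 2) ∈ Wset (l + 1)) :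
    rankW (l + 1) (Fin.cons 1 v) = mW l + rankW l v := by
  have key : (Wset (l + 1)).filter (fun u => lexLt (l + 1) u (Fin.cons 1 v)) =
      (Wset l).image (fun u => (Fin.cons 0 u : Fin (l + 1) → Fin 2)) ∪
      ((Wset l).filter (fun u => lexLt l u v)).image
        (fun u => (Fin.cons 1 u : Fin (l + 1) → Fin 2)) := by
    ext u
    simp only [mem_filter, mem_image, mem_union]
    constructor
    · rintro ⟨hu, hlt⟩
      obtain ⟨x, hx, rfl⟩ | ⟨x, hx, rfl, -⟩ := Wset_succ_cases hu
      · exact Or.inl ⟨x, hx, rfl⟩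
      · exact Or.inr ⟨x, ⟨hx, by simpa [lexLt_cons] using hlt⟩, rfl⟩
    · rintro (⟨x, hx, rfl⟩ | ⟨x, ⟨hx, hlt⟩, rfl⟩)
      · exact ⟨zero_cons_mem_Wset.2 hx, by simp [lexLt_cons]⟩
      · exact ⟨one_cons_mem_of_lexLt hx hv hlt, by simpa [lexLt_cons] using hlt⟩
  unfold rankW mW
  rw [key, card_union_of_disjoint, card_image_of_injective _ (cons_injective 0),
    card_image_of_injective _ (cons_injective 1)]
  · omega
  · rw [disjoint_left]
    intro u h0 h1
    simp only [mem_image] at h0 h1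
    obtain ⟨x, -, rfl⟩ := h0
    obtain ⟨y, -, h⟩ := h1
    simpa using congrFun h 0

theorem one_le_rankW (l : ℕ) (w : Fin l → Fin 2) : 1 ≤ rankW l w :=
  Nat.le_add_right _ _

theorem rankW_le_mW {l : ℕ} {w : Fin l → Fin 2} (hw : w ∈ Wset l) : rankW l w ≤ mW l := by
  have : (Wset l).filter (fun u => lexLt l u w) ⊂ Wset l :=
    (filter_ssubset).2 ⟨w, hw, fun ⟨_, _, h⟩ => lt_irrefl _ h⟩
  have := card_lt_card this
  unfold rankW mW
  omega

theorem rankW_inj {l : ℕ} {u w : Fin l → Fin 2} (hu : u ∈ Wset l) (hw : w ∈ Wset l) :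
    rankW l u = rankW l w ↔ u = w := by
  refine ⟨fun h => ?_, fun h => h ▸ rfl⟩
  induction l with
  | zero => exact Subsingleton.elim _ _
  | succ l ih =>
    obtain ⟨x, hx, rfl⟩ | ⟨x, hx, rfl, hx'⟩ := Wset_succ_cases hu <;>
    obtain ⟨y, hy, rfl⟩ | ⟨y, hy, rfl, hy'⟩ := Wset_succ_cases hw
    · rw [rankW_zero_cons, rankW_zero_cons] at h
      rw [ih hx hy h]
    · rw [rankW_zero_cons, rankW_one_cons hy'] at h
      have := rankW_le_mW hx
      have := one_le_rankW l y
      omega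
    · rw [rankW_zero_cons, rankW_one_cons hx'] at h
      have := rankW_le_mW hy
      have := one_le_rankW l x
      omega
    · rw [rankW_one_cons hx', rankW_one_cons hy'] at h
      rw [ih hx hy (by omega)]

theorem exists_rankW_eq {l i : ℕ} (h1 : 1 ≤ i) (h2 : i ≤ mW l) :
    ∃ w ∈ Wset l, rankW l w = i := by
  obtain ⟨w, hw, h⟩ := surj_on_of_inj_on_of_card_le (s := Wset l) (t := Icc 1 (mW l))
    (fun w _ => rankW l w) (fun w hw => mem_Icc.2 ⟨one_le_rankW l w, rankW_le_mW hw⟩)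
    (fun u w hu hw h => (rankW_inj hu hw).1 h) (by simp [mW]) i (mem_Icc.2 ⟨h1, h2⟩)
  exact ⟨w, hw, h.symm⟩

theorem mW_zero : mW 0 = 1 := by decide

theorem mW_one : mW 1 = 2 := by decide

theorem mW_two : mW 2 = 3 := by decide

theorem rankW_zero (w : Fin 0 → Fin 2) : rankW 0 w = 1 := by
  have : w ∈ Wset 0 := mem_Wset.2 fun i => i.elim0
  have := rankW_le_mW this
  have := one_le_rankW 0 w
  rw [mW_zero] at *
  omega

/-- The words `v` of length `l` and `v'` of length `l + 2` agree in the first `l` letters. -/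
def IsPrefix {l : ℕ} (v : Fin l → Fin 2) (v' : Fin (l + 2) → Fin 2) : Prop :=
  ∀ t : Fin l, v t = v' t.castSucc.castSucc

instance {l : ℕ} (v : Fin l → Fin 2) (v' : Fin (l + 2) → Fin 2) : Decidable (IsPrefix v v') := by
  unfold IsPrefix; infer_instance

theorem isPrefix_cons {l : ℕ} (a b : Fin 2) (v : Fin l → Fin 2) (v' : Fin (l + 2) → Fin 2) :
    IsPrefix (Fin.cons a v : Fin (l + 1) → Fin 2) (Fin.cons b v' : Fin (l + 3) → Fin 2) ↔
      a = b ∧ IsPrefix v v' := by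
  simp only [IsPrefix, Fin.forall_fin_succ, Fin.cons_zero, Fin.cons_succ, Fin.castSucc_zero,
    ← Fin.succ_castSucc]

/-- The entry of `S_{l+1}` at `(v, v')` tells whether `v` is a prefix of `v'`. -/
theorem Smat_succ_rankW {l : ℕ} {v : Fin l → Fin 2} {v' : Fin (l + 2) → Fin 2}
    (hv : v ∈ Wset l) (hv' : v' ∈ Wset (l + 2)) :
    Smat (l + 1) (rankW l v) (rankW (l + 2) v') = if IsPrefix v v' then 1 else 0 := by
  induction l using Nat.strong_induction_on with
  | _ l ih =>
  cases l with
  | zero =>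
    have h1 := one_le_rankW 2 v'
    have h2 := rankW_le_mW hv'
    rw [mW_two] at h2
    simp [Smat, rankW_zero, h1, h2, IsPrefix]
  | succ l =>
    obtain ⟨x, hx, rfl⟩ | ⟨x, hx, rfl, hx'⟩ := Wset_succ_cases hv <;>
    obtain ⟨y, hy, rfl⟩ | ⟨y, hy, rfl, hy'⟩ := Wset_succ_cases hv'
    · rw [rankW_zero_cons, rankW_zero_cons, Smat, if_pos (rankW_le_mW hx),
        if_pos (rankW_le_mW hy), ih l (Nat.lt_succ_self l) hx hy]
      simp [isPrefix_cons]
    · have := one_le_rankW _ y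
      rw [rankW_zero_cons, rankW_one_cons hy', Smat, if_pos (rankW_le_mW hx),
        if_neg (by omega)]
      simp [isPrefix_cons]
    · have := one_le_rankW _ x
      rw [rankW_zero_cons, rankW_one_cons hx', Smat, if_neg (by omega),
        if_pos (rankW_le_mW hy)]
      simp [isPrefix_cons]
    · have h1 := one_le_rankW _ x
      have h2 := one_le_rankW _ y
      rw [rankW_one_cons hx', rankW_one_cons hy', Smat, if_neg (by omega), if_neg (by omega),
        Nat.add_sub_cancel_left, Nat.add_sub_cancel_left]
      obtain ⟨z', hz', rfl⟩ := exists_zero_cons_of_one_cons_mem hy'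
      rw [rankW_zero_cons]
      cases l with
      | zero =>
        have h3 := one_le_rankW _ z'
        have h4 := rankW_le_mW hz'
        rw [mW_one] at h4
        simp [Smat, rankW_zero, h3, h4, IsPrefix]
      | succ l =>
        obtain ⟨z, hz, rfl⟩ := exists_zero_cons_of_one_cons_mem hx'
        rw [rankW_zero_cons, ih l (by omega) hz hz']
        simp [isPrefix_cons]

/-- The prefixing part of `M_{l+1,l+2}` is the matrix `Q`. -/
theorem ite_tail_eq {l : ℕ} {w : Fin (l + 1) → Fin 2} {w' : Fin (l + 2) → Fin 2}
    (hw : w ∈ Wset (l + 1)) (hw' : w' ∈ Wset (l + 2)) :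
    (if ∀ t : Fin (l + 1), w' t.succ = w t then (1 : ℤ) else 0) =
      (if rankW (l + 1) w = rankW (l + 2) w' then 1 else 0) +
      (if rankW (l + 2) w' = mW (l + 1) + rankW (l + 1) w ∧ rankW (l + 1) w ≤ mW l
        then 1 else 0) := by
  have hwm := rankW_le_mW hw
  have hw1 := one_le_rankW _ w
  obtain ⟨y, hy, rfl⟩ | ⟨y, hy, rfl, hy'⟩ := Wset_succ_cases hw'
  · have := rankW_le_mW hy
    rw [rankW_zero_cons, if_neg (c := _ ∧ _) (by omega), add_zero]
    simp only [Fin.cons_succ, ← funext_iff, rankW_inj hw hy, eq_comm]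
  · have := one_le_rankW _ y
    rw [rankW_one_cons hy', if_neg (c := rankW _ w = _) (by omega), zero_add]
    simp only [Fin.cons_succ, ← funext_iff, Nat.add_left_cancel_iff, rankW_inj hy hw]
    obtain ⟨z, hz, rfl⟩ := exists_zero_cons_of_one_cons_mem hy'
    refine if_congr ⟨fun h => ⟨h, ?_⟩, fun h => h.1⟩ rfl rfl
    rw [← h, rankW_zero_cons]
    exact rankW_le_mW hz

/-- The shifting part of `M_{l+1,l+2}` is the matrix `P`. -/
theorem ite_shift_eq {l : ℕ} {w : Fin (l + 1) → Fin 2} {w' : Fin (l + 2) → Fin 2}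
    (hw : w ∈ Wset (l + 1)) (hw' : w' ∈ Wset (l + 2)) :
    (if ¬(w 0 = 1 ∧ w' 0 = 1) ∧ IsPrefix (Fin.tail w) w' then (1 : ℤ) else 0) =
      if rankW (l + 1) w ≤ mW l then Smat (l + 1) (rankW (l + 1) w) (rankW (l + 2) w')
      else if rankW (l + 2) w' ≤ mW (l + 1) then
        Smat l (rankW (l + 1) w - mW l) (rankW (l + 2) w') else 0 := by
  obtain ⟨x, hx, rfl⟩ | ⟨x, hx, rfl, hx'⟩ := Wset_succ_cases hw
  · rw [rankW_zero_cons, if_pos (rankW_le_mW hx), Smat_succ_rankW hx hw']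
    simp
  · have := one_le_rankW _ x
    rw [rankW_one_cons hx', if_neg (c := _ ≤ _) (by omega), Nat.add_sub_cancel_left]
    obtain ⟨y, hy, rfl⟩ | ⟨y, hy, rfl, hy'⟩ := Wset_succ_cases hw'
    · rw [rankW_zero_cons, if_pos (c := _ ≤ _) (rankW_le_mW hy)]
      cases l with
      | zero =>
        have h3 := one_le_rankW _ y
        have h4 := rankW_le_mW hy
        rw [mW_one] at h4
        simp [Smat, rankW_zero, h3, h4, IsPrefix]
      | succ l =>
        obtain ⟨z, hz, rfl⟩ := exists_zero_cons_of_one_cons_mem hx'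
        rw [rankW_zero_cons, Smat_succ_rankW hz hy]
        simp [isPrefix_cons]
    · have := one_le_rankW _ y
      rw [rankW_one_cons hy', if_neg (c := _ ≤ _) (by omega)]
      simp

theorem Mmat_succ_rankW {l : ℕ} {w : Fin (l + 1) → Fin 2} {w' : Fin (l + 2) → Fin 2}
    (hw : w ∈ Wset (l + 1)) (hw' : w' ∈ Wset (l + 2)) :
    Mmat (l + 1) (rankW (l + 1) w) (rankW (l + 2) w') =
      (if ∀ t : Fin (l + 1), w' t.succ = w t then (1 : ℤ) else 0) +
      (if ¬(w 0 = 1 ∧ w' 0 = 1) ∧ IsPrefix (Fin.tail w) w' then (1 : ℤ) else 0) := by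
  rw [Mmat, sum_eq_single_of_mem w hw, sum_eq_single_of_mem w' hw']
  · rw [if_pos ⟨rfl, rfl⟩]
    congr 1
    refine if_congr (and_congr_right fun _ => ?_) rfl rfl
    rw [Fin.forall_fin_succ]
    simp [IsPrefix, Fin.tail, Fin.castSucc, Fin.castAdd, Fin.castLE]
  · intro u hu hne
    exact if_neg fun h => hne ((rankW_inj hu hw').1 h.2)
  · intro u hu hne
    exact sum_eq_zero fun _ _ => if_neg fun h => hne ((rankW_inj hu hw).1 h.1)

/-- for every `l ≥ 1`, `M_{l,l+1} = P + Q`, where the first `m(l-1)` rows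
of `P` form `S_l`, the remaining (last `m(l-2)`) rows of `P` form `[S_{l-1} | 0]`,
and `Q` has the `m(l) × m(l)` identity in its first `m(l)` columns and
`Q(i, m(l)+i) = 1` for `1 ≤ i ≤ m(l-1)`, all other entries `0`. -/
theorem Mmat_eq_S_add_Q (l : ℕ) (hl : 1 ≤ l) :
    ∀ i j : ℕ, 1 ≤ i → i ≤ mW l → 1 ≤ j → j ≤ mW (l + 1) →
      Mmat l i j =
        ((if i ≤ mW (l - 1) then Smat l i j
          else if j ≤ mW l then Smat (l - 1) (i - mW (l - 1)) j else 0)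
         + ((if i = j then 1 else 0)
            + (if j = mW l + i ∧ i ≤ mW (l - 1) then 1 else 0))) := by
  intro i j hi hi' hj hj'
  obtain ⟨l, rfl⟩ := Nat.exists_eq_add_of_le' hl
  obtain ⟨w, hw, rfl⟩ := exists_rankW_eq hi hi'
  obtain ⟨w', hw', rfl⟩ := exists_rankW_eq hj hj'
  rw [Mmat_succ_rankW hw hw', ite_tail_eq hw hw', ite_shift_eq hw hw', add_comm]
  rfl
end
end

section
/- For every l ≥ 0, the matrices satisfy the compatibility relation I_{l,l+1} M_{l+1,l+2} = M_{l,l+1} I_{l+1,l+2} (as m(l) × m(l+2) integer matrices). -/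
noncomputable section



open Finset

theorem lexLt_irrefl {l : ℕ} (w : Fin l → Fin 2) : ¬ lexLt l w w := by
  rintro ⟨i, _, h⟩
  exact lt_irrefl _ h

theorem lexLt_trans {l : ℕ} {u v w : Fin l → Fin 2} (huv : lexLt l u v) (hvw : lexLt l v w) :
    lexLt l u w := by
  obtain ⟨i, hi, hi'⟩ := huv
  obtain ⟨k, hk, hk'⟩ := hvw
  rcases lt_trichotomy i k with h | rfl | h
  · exact ⟨i, fun j hj => (hi j hj).trans (hk j (hj.trans h)), hk i h ▸ hi'⟩
  · exact ⟨i, fun j hj => (hi j hj).trans (hk j hj), hi'.trans hk'⟩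
  · exact ⟨k, fun j hj => (hi j (hj.trans h)).trans (hk j hj), (hi k h).symm ▸ hk'⟩

theorem lexLt_or_lexLt_of_ne {l : ℕ} {u w : Fin l → Fin 2} (h : u ≠ w) :
    lexLt l u w ∨ lexLt l w u := by
  obtain ⟨a, ha⟩ := Function.ne_iff.mp h
  obtain ⟨i, hi, hmin⟩ := WellFounded.has_min (wellFounded_lt (α := Fin l))
    {a | u a ≠ w a} ⟨a, ha⟩
  have heq : ∀ j < i, u j = w j := fun j hj => by
    by_contra hne
    exact hmin j hne hj
  rcases lt_or_gt_of_ne (show u i ≠ w i from hi) with h | h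
  · exact Or.inl ⟨i, heq, h⟩
  · exact Or.inr ⟨i, fun j hj => (heq j hj).symm, h⟩

theorem rankW_lt_rankW {l : ℕ} {u w : Fin l → Fin 2} (hu : u ∈ Wset l) (h : lexLt l u w) :
    rankW l u < rankW l w := by
  refine Nat.add_lt_add_left (Finset.card_lt_card ?_) 1
  refine (Finset.ssubset_iff_of_subset ?_).mpr ⟨u, ?_, ?_⟩
  · intro v hv
    rw [Finset.mem_filter] at hv ⊢
    exact ⟨hv.1, lexLt_trans hv.2 h⟩
  · exact Finset.mem_filter.mpr ⟨hu, h⟩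
  · exact fun hv => lexLt_irrefl u (Finset.mem_filter.mp hv).2

theorem rankW_injOn (l : ℕ) : Set.InjOn (rankW l) (Wset l) := by
  intro u hu w hw h
  by_contra hne
  rcases lexLt_or_lexLt_of_ne hne with hlt | hlt
  · exact (rankW_lt_rankW hu hlt).ne h
  · exact (rankW_lt_rankW hw hlt).ne' h

theorem rankW_mem_Icc {l : ℕ} {w : Fin l → Fin 2} (hw : w ∈ Wset l) :
    rankW l w ∈ Finset.Icc 1 (mW l) := by
  refine Finset.mem_Icc.mpr ⟨Nat.le_add_right _ _, ?_⟩
  have : ((Wset l).filter (fun u => lexLt l u w)).card < (Wset l).card :=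
    Finset.card_lt_card (Finset.filter_ssubset.mpr ⟨w, hw, lexLt_irrefl w⟩)
  unfold rankW mW
  omega

theorem image_rankW (l : ℕ) : (Wset l).image (rankW l) = Finset.Icc 1 (mW l) := by
  refine Finset.eq_of_subset_of_card_le ?_ ?_
  · exact Finset.image_subset_iff.mpr fun w hw => rankW_mem_Icc hw
  · rw [Finset.card_image_of_injOn (rankW_injOn l), Nat.card_Icc, Nat.add_sub_cancel]
    rfl

theorem sum_Icc_mW (l : ℕ) (f : ℕ → ℤ) :
    ∑ k ∈ Finset.Icc 1 (mW l), f k = ∑ w ∈ Wset l, f (rankW l w) := by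
  rw [← image_rankW, Finset.sum_image (rankW_injOn l)]

theorem Imat_rankW {l : ℕ} {w : Fin l → Fin 2} {w' : Fin (l + 1) → Fin 2} (hw : w ∈ Wset l)
    (hw' : w' ∈ Wset (l + 1)) :
    Imat l (rankW l w) (rankW (l + 1) w') = if w = Fin.init w' then 1 else 0 := by
  unfold Imat
  refine if_congr ⟨?_, fun h => ⟨w, hw, w', hw', rfl, rfl, fun k => congrFun h k⟩⟩ rfl rfl
  rintro ⟨v, hv, v', hv', h, h', hk⟩
  obtain rfl := rankW_injOn l hv hw h
  obtain rfl := rankW_injOn (l + 1) hv' hw' h'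
  exact funext hk

/-- The relation defining `ε(w, w') = 1`. -/
def ShiftRel {l : ℕ} (w : Fin (l + 1) → Fin 2) (w' : Fin (l + 2) → Fin 2) : Prop :=
  ¬(w 0 = 1 ∧ w' 0 = 1) ∧ ∀ t : Fin l, w t.succ = w' t.castSucc.castSucc

instance {l : ℕ} (w : Fin (l + 1) → Fin 2) (w' : Fin (l + 2) → Fin 2) :
    Decidable (ShiftRel w w') := by
  unfold ShiftRel; infer_instance

theorem Mmat_rankW {l : ℕ} {w : Fin (l + 1) → Fin 2} {w' : Fin (l + 2) → Fin 2}
    (hw : w ∈ Wset (l + 1)) (hw' : w' ∈ Wset (l + 2)) :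
    Mmat (l + 1) (rankW (l + 1) w) (rankW (l + 2) w') =
      (if Fin.tail w' = w then 1 else 0) + (if ShiftRel w w' then 1 else 0) := by
  simp only [Mmat]
  rw [Finset.sum_eq_single_of_mem w hw, Finset.sum_eq_single_of_mem w' hw', if_pos ⟨rfl, rfl⟩]
  · refine congrArg₂ _ (if_congr ⟨fun h => funext h, fun h => congrFun h⟩ rfl rfl)
      (if_congr (and_congr_right' ⟨fun h t => h t.succ (Nat.succ_ne_zero _), fun h t ht => ?_⟩)
        rfl rfl)
    obtain ⟨s, rfl⟩ := Fin.exists_succ_eq.mpr (fun h0 : t = 0 => ht (congrArg Fin.val h0))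
    exact h s
  · exact fun v' hv' hne => if_neg fun h => hne (rankW_injOn _ hv' hw' h.2)
  · exact fun v hv hne => Finset.sum_eq_zero fun v' _ =>
      if_neg fun h => hne (rankW_injOn _ hv hw h.1)

theorem init_mem_Wset {l : ℕ} {w : Fin (l + 1) → Fin 2} (hw : w ∈ Wset (l + 1)) :
    Fin.init w ∈ Wset l :=
  mem_Wset.mpr fun i j h => mem_Wset.mp hw i.castSucc j.castSucc h

theorem tail_mem_Wset {l : ℕ} {w : Fin (l + 1) → Fin 2} (hw : w ∈ Wset (l + 1)) :
    Fin.tail w ∈ Wset l :=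
  mem_Wset.mpr fun i j h => mem_Wset.mp hw i.succ j.succ (by simp [h])

theorem snoc_mem_Wset {l : ℕ} {w : Fin (l + 1) → Fin 2} (hw : w ∈ Wset (l + 1)) {a : Fin 2}
    (ha : ¬(w (Fin.last l) = 1 ∧ a = 1)) :
    (Fin.snoc w a : Fin (l + 2) → Fin 2) ∈ Wset (l + 2) := by
  refine mem_Wset.mpr fun i j h => ?_
  induction i using Fin.lastCases with
  | last => exact absurd j.isLt (by simp at h; omega)
  | cast i =>
    induction j using Fin.lastCases with
    | last =>
      have hi : i = Fin.last l := Fin.ext (by simp at h ⊢; omega)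
      simpa [hi] using ha
    | cast j => simpa using mem_Wset.mp hw i j h

/-- Admissible extensions of `w` related to `w'` are unique, and exist when `w` is related to
the truncation of `w'`. -/
theorem init_and_shiftRel_iff {l : ℕ} {w : Fin (l + 1) → Fin 2} {v : Fin (l + 2) → Fin 2}
    {w' : Fin (l + 3) → Fin 2} :
    (w = Fin.init v ∧ ShiftRel v w') ↔
      (v = Fin.snoc w (w' (Fin.last l).castSucc.castSucc) ∧ ShiftRel w (Fin.init w')) := by
  constructor
  · rintro ⟨rfl, h0, h⟩
    refine ⟨?_, h0, fun t => h t.castSucc⟩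
    rw [← h (Fin.last l), Fin.succ_last, Fin.snoc_init_self]
  · rintro ⟨rfl, h0, h⟩
    refine ⟨(Fin.init_snoc (α := fun _ => Fin 2) _ w).symm, ?_, fun t => ?_⟩
    · have : (Fin.snoc w (w' (Fin.last l).castSucc.castSucc) : Fin (l + 2) → Fin 2) 0 = w 0 :=
        Fin.snoc_castSucc (α := fun _ => Fin 2) _ w 0
      rw [this]
      exact h0
    · induction t using Fin.lastCases with
      | last => rw [Fin.succ_last]; exact Fin.snoc_last (α := fun _ => Fin 2) _ w
      | cast t =>
        rw [Fin.succ_castSucc]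
        exact (Fin.snoc_castSucc (α := fun _ => Fin 2) _ w t.succ).trans (h t)

theorem not_last_eq_one_of_shiftRel {l : ℕ} {w : Fin (l + 1) → Fin 2}
    {w' : Fin (l + 3) → Fin 2} (hw' : w' ∈ Wset (l + 3)) (h : ShiftRel w (Fin.init w')) :
    ¬(w (Fin.last l) = 1 ∧ w' (Fin.last l).castSucc.castSucc = 1) := by
  obtain ⟨h0, h⟩ := h
  cases l with
  | zero => exact h0
  | succ l =>
    rw [← Fin.succ_last, h (Fin.last l)]
    exact mem_Wset.mp hw' _ _ (by simp)

theorem sum_Wset_eq {l : ℕ} {w : Fin (l + 1) → Fin 2} {w' : Fin (l + 3) → Fin 2}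
    (hw : w ∈ Wset (l + 1)) (hw' : w' ∈ Wset (l + 3)) :
    ∑ v ∈ Wset (l + 2), (if w = Fin.init v then (1 : ℤ) else 0) *
        ((if Fin.tail w' = v then 1 else 0) + (if ShiftRel v w' then 1 else 0)) =
      (if Fin.tail (Fin.init w') = w then 1 else 0) +
        (if ShiftRel w (Fin.init w') then 1 else 0) := by
  simp only [mul_add, Finset.sum_add_distrib]
  congr 1
  · simp only [mul_ite, mul_one, mul_zero, Finset.sum_ite_eq, if_pos (tail_mem_Wset hw')]
    rw [← Fin.tail_init_eq_init_tail]
    exact if_congr eq_comm rfl rfl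
  · simp only [ite_zero_mul_ite_zero, mul_one, init_and_shiftRel_iff]
    by_cases h : ShiftRel w (Fin.init w')
    · simp [h, snoc_mem_Wset hw (not_last_eq_one_of_shiftRel hw' h)]
    · simp [h]

/-- the compatibility relation `I_{l,l+1} M_{l+1,l+2} = M_{l,l+1} I_{l+1,l+2}`
(as `m(l) × m(l+2)` matrices), for every `l ≥ 0`. -/
theorem Imat_Mmat_compatibility (l : ℕ) :
    ∀ i j : ℕ, 1 ≤ i → i ≤ mW l → 1 ≤ j → j ≤ mW (l + 2) →
      ∑ k ∈ Finset.Icc 1 (mW (l + 1)), Imat l i k * Mmat (l + 1) k j =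
      ∑ k ∈ Finset.Icc 1 (mW (l + 1)), Mmat l i k * Imat (l + 1) k j := by
  intro i j hi hi' hj hj'
  cases l with
  | zero =>
    have h0 : mW 0 = 1 := by decide +kernel
    have h2 : mW 2 = 3 := by decide +kernel
    obtain rfl : i = 1 := by omega
    have hj3 : j ≤ 3 := by rwa [zero_add, h2] at hj'
    interval_cases j <;> decide +kernel
  | succ l =>
    obtain ⟨w, hw, rfl⟩ := exists_rankW_eq hi hi'
    obtain ⟨w', hw', rfl⟩ := exists_rankW_eq hj hj'
    rw [sum_Icc_mW, sum_Icc_mW]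
    calc
      _ = ∑ v ∈ Wset (l + 2), (if w = Fin.init v then (1 : ℤ) else 0) *
            ((if Fin.tail w' = v then 1 else 0) + (if ShiftRel v w' then 1 else 0)) :=
        Finset.sum_congr rfl fun v hv => by rw [Imat_rankW hw hv, Mmat_rankW hv hw']
      _ = (if Fin.tail (Fin.init w') = w then 1 else 0) +
            (if ShiftRel w (Fin.init w') then 1 else 0) := sum_Wset_eq hw hw'
      _ = ∑ v ∈ Wset (l + 2), Mmat (l + 1) (rankW (l + 1) w) (rankW (l + 2) v) *
            (if v = Fin.init w' then 1 else 0) := by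
        simp only [mul_ite, mul_one, mul_zero, Finset.sum_ite_eq', if_pos (init_mem_Wset hw')]
        exact (Mmat_rankW hw (init_mem_Wset hw')).symm
      _ = _ := Finset.sum_congr rfl fun v hv => by rw [Imat_rankW hv hw']
end
end

section
/- Write 𝔸_{l+1,l} = M_{l,l+1}^t − I_{l,l+1}^t in 2×2 block form 𝔸_{l+1,l} = [[𝔸^{UL}_{l+1,l}, 𝔸^{UR}_{l+1,l}],[𝔸^{LL}_{l+1,l}, 𝔸^{LR}_{l+1,l}]], where 𝔸^{UL} is m(l) × m(l−1), 𝔸^{UR} is m(l) × m(l−2), 𝔸^{LL} is m(l−1) × m(l−1) and 𝔸^{LR} is m(l−1) × m(l−2). Then for every l ≥ 3 the blocks satisfy the recursions: 𝔸^{UL}_{l+2,l+1} = [[𝔸^{UL}_{l+1,l}, (0_{l−1,l−2} stacked over the m(l−2) × m(l−2) identity)],[0_{l−1,l−2}, S_{l−2}^t, 𝔸^{LR}_{l+1,l}]] (i.e. its upper-left m(l) × m(l−1) block is 𝔸^{UL}_{l+1,l}, its upper-right m(l) × m(l−2) block is the zero m(l−1) × m(l−2) matrix stacked over the m(l−2)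 × m(l−2) identity, and its bottom m(l−1) rows are [0_{l−1,l−2} | S^t_{l−2} | 𝔸^{LR}_{l+1,l}]); 𝔸^{UR}_{l+2,l+1} = [[S_{l−1}^t, 0_{l,l−3}],[𝔸^{LL}_{l+1,l}]]; 𝔸^{LL}_{l+2,l+1} = [[(I_{m(l−1)} stacked over 0_{l−2,l−1}), 𝔸^{UR}_{l+1,l}]]; and 𝔸^{LR}_{l+2,l+1} = [[𝔸^{LR}_{l+1,l}, 0_{l−1,l−3}],[0_{l−2,l−2}, 𝔸^{LR}_{l,l−1}]]. Here 0_{p,q} denotes the m(p) × m(q) zero matrix and S^t_k is the transpose of S_k. -/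
noncomputable section



open Finset

/-- The matrix `𝔸_{l+1,l} = M_{l,l+1}^t − I_{l,l+1}^t` (1-based indices). -/
def AmatN (l : ℕ) : ℕ → ℕ → ℤ := fun i j => Mmat l j i - Imat l j i

/-- `𝔸_{l+1,l} = M_{l,l+1}^t − I_{l,l+1}^t` as an `m(l+1) × m(l)` matrix over `Fin` types. -/
def AMat (l : ℕ) : Matrix (Fin (mW (l + 1))) (Fin (mW l)) ℤ :=
  fun i j => AmatN l ((i : ℕ) + 1) ((j : ℕ) + 1)

theorem dyckAdm_tail {l : ℕ} {w : Fin (l + 1) → Fin 2} (h : DyckAdm (l + 1) w) :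
    DyckAdm l (Fin.tail w) := fun i j hij =>
  h i.succ j.succ (by simp [hij])

theorem dyckAdm_init {l : ℕ} {w : Fin (l + 1) → Fin 2} (h : DyckAdm (l + 1) w) :
    DyckAdm l (Fin.init w) := fun i j hij =>
  h i.castSucc j.castSucc (by simp [hij])

theorem dyckAdm_cons_zero {l : ℕ} {w : Fin l → Fin 2} (h : DyckAdm l w) :
    DyckAdm (l + 1) (Fin.cons 0 w) := by
  intro i j hij
  induction i using Fin.cases with
  | zero => simp
  | succ i =>
    induction j using Fin.cases with
    | zero => simp at hij
    | succ j => simpa using h i j (by simpa using hij)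

theorem dyckAdm_cons_one {l : ℕ} {w : Fin (l + 1) → Fin 2} (h : DyckAdm (l + 1) w)
    (h0 : w 0 = 0) : DyckAdm (l + 2) (Fin.cons 1 w) := by
  intro i j hij
  induction j using Fin.cases with
  | zero => simp at hij
  | succ j =>
    induction i using Fin.cases with
    | zero =>
      have hj : j = 0 := by ext; simpa using hij
      simp [hj, h0]
    | succ i => simpa using h i j (by simpa using hij)

theorem tail_zero_of_dyckAdm {l : ℕ} {w : Fin (l + 2) → Fin 2} (h : DyckAdm (l + 2) w)
    (h0 : w 0 = 1) : Fin.tail w 0 = 0 := by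
  have := h 0 1 (by simp)
  have h1 : w 1 ≠ 1 := fun h1 => this ⟨h0, h1⟩
  change w 1 = 0
  omega

theorem Wset_succ_zero_filter (l : ℕ) :
    (Wset (l + 1)).filter (fun w => w 0 = 0) = (Wset l).image (Fin.cons 0) := by
  ext w
  simp only [mem_filter, mem_image, mem_Wset]
  constructor
  · rintro ⟨h, h0⟩
    exact ⟨Fin.tail w, dyckAdm_tail h, by rw [← h0, Fin.cons_self_tail]⟩
  · rintro ⟨u, hu, rfl⟩
    exact ⟨dyckAdm_cons_zero hu, rfl⟩

theorem Wset_add_two_one_filter (l : ℕ) :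
    (Wset (l + 2)).filter (fun w => ¬ w 0 = 0) =
      ((Wset (l + 1)).filter (fun w => w 0 = 0)).image (Fin.cons 1) := by
  ext w
  simp only [mem_filter, mem_image, mem_Wset]
  constructor
  · rintro ⟨h, h0⟩
    have h1 : w 0 = 1 := by omega
    exact ⟨Fin.tail w, ⟨dyckAdm_tail h, tail_zero_of_dyckAdm h h1⟩,
      by rw [← h1, Fin.cons_self_tail]⟩
  · rintro ⟨u, ⟨hu, hu0⟩, rfl⟩
    exact ⟨dyckAdm_cons_one hu hu0, by simp⟩

theorem card_Wset_zero_filter (l : ℕ) :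
    ((Wset (l + 1)).filter (fun w => w 0 = 0)).card = mW l := by
  rw [Wset_succ_zero_filter, card_image_of_injective _ (Fin.cons_right_injective
      (α := fun _ => Fin 2) 0), mW]

theorem mW_add_two (l : ℕ) : mW (l + 2) = mW (l + 1) + mW l := by
  rw [mW, ← card_filter_add_card_filter_not (fun w : Fin (l + 2) → Fin 2 => w 0 = 0),
    card_Wset_zero_filter, Wset_add_two_one_filter,
    card_image_of_injective _ (Fin.cons_right_injective
      (α := fun _ => Fin 2) 1), card_Wset_zero_filter]

/-- The Zeckendorf value of a word: its 0-based position among the admissible words. -/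
def zeckVal : (l : ℕ) → (Fin l → Fin 2) → ℕ
  | 0, _ => 0
  | l + 1, w => (if w 0 = 1 then mW l else 0) + zeckVal l (Fin.tail w)

theorem lexLt_succ {l : ℕ} {u w : Fin (l + 1) → Fin 2} :
    lexLt (l + 1) u w ↔ u 0 < w 0 ∨ u 0 = w 0 ∧ lexLt l (Fin.tail u) (Fin.tail w) := by
  constructor
  · rintro ⟨i, hi, hlt⟩
    induction i using Fin.cases with
    | zero => exact Or.inl hlt
    | succ i =>
      exact Or.inr ⟨hi 0 (Fin.succ_pos i), i,
        fun j hj => hi j.succ (Fin.succ_lt_succ_iff.2 hj), hlt⟩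
  · rintro (h | ⟨h0, i, hi, hlt⟩)
    · exact ⟨0, fun j hj => absurd hj (Fin.not_lt_zero j), h⟩
    · refine ⟨i.succ, fun j hj => ?_, hlt⟩
      induction j using Fin.cases with
      | zero => exact h0
      | succ j => exact hi j (Fin.succ_lt_succ_iff.1 hj)

theorem dyckAdm_cons_of_lexLt {l : ℕ} {w : Fin (l + 1) → Fin 2} (hw : DyckAdm (l + 1) w)
    {v : Fin l → Fin 2} (hv : DyckAdm l v) (hlt : lexLt l v (Fin.tail w)) :
    DyckAdm (l + 1) (Fin.cons (w 0) v) := by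
  by_cases h0 : w 0 = 0
  · rw [h0]; exact dyckAdm_cons_zero hv
  have h1 : w 0 = 1 := by omega
  cases l with
  | zero => exact (hlt.choose).elim0
  | succ l =>
    rw [h1]
    refine dyckAdm_cons_one hv ?_
    have ht := tail_zero_of_dyckAdm hw h1
    rcases lexLt_succ.1 hlt with h | h
    · omega
    · exact h.1.trans ht

theorem card_filter_lexLt {l : ℕ} {w : Fin l → Fin 2} (hw : DyckAdm l w) :
    ((Wset l).filter (fun u => lexLt l u w)).card = zeckVal l w := by
  induction l with
  | zero =>
    rw [zeckVal, card_eq_zero, filter_eq_empty_iff]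
    rintro u - ⟨i, -⟩
    exact i.elim0
  | succ l ih =>
    have hsplit : (Wset (l + 1)).filter (fun u => lexLt (l + 1) u w) =
        (if w 0 = 1 then (Wset (l + 1)).filter (fun u => u 0 = 0) else ∅) ∪
          ((Wset l).filter (fun u => lexLt l u (Fin.tail w))).image (Fin.cons (w 0)) := by
      ext u
      simp only [mem_filter, mem_union, mem_image, mem_Wset, lexLt_succ]
      constructor
      · rintro ⟨hu, h | ⟨h0, h⟩⟩
        · left
          have h1 : w 0 = 1 := by omega
          have h2 : u 0 = 0 := by omega
          simp [h1, h2, mem_Wset, hu]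
        · exact Or.inr ⟨Fin.tail u, ⟨dyckAdm_tail hu, h⟩, by rw [← h0, Fin.cons_self_tail]⟩
      · rintro (h | ⟨v, ⟨hv, hlt⟩, rfl⟩)
        · split_ifs at h with h1
          · simp only [mem_filter, mem_Wset] at h
            exact ⟨h.1, Or.inl (by rw [h.2, h1]; decide)⟩
          · simp at h
        · exact ⟨dyckAdm_cons_of_lexLt hw hv hlt, Or.inr ⟨rfl, by simpa using hlt⟩⟩
    rw [hsplit, card_union_of_disjoint, card_image_of_injective _ (Fin.cons_right_injective
      (α := fun _ => Fin 2) _),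
      ih (dyckAdm_tail hw), zeckVal, apply_ite card, card_Wset_zero_filter, card_empty]
    rw [disjoint_left]
    intro u hu hu'
    obtain ⟨v, -, rfl⟩ := mem_image.1 hu'
    split_ifs at hu with h1
    · have := (mem_filter.1 hu).2
      simp [h1] at this
    · simp at hu

theorem rankW_eq {l : ℕ} {w : Fin l → Fin 2} (hw : w ∈ Wset l) :
    rankW l w = zeckVal l w + 1 := by
  rw [rankW, card_filter_lexLt (mem_Wset.1 hw), add_comm]

theorem zeckVal_lt {l : ℕ} {w : Fin l → Fin 2} (hw : DyckAdm l w) : zeckVal l w < mW l := by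
  rw [← card_filter_lexLt hw, mW]
  refine card_lt_card (filter_ssubset.2 ⟨w, mem_Wset.2 hw, ?_⟩)
  rintro ⟨i, -, h⟩
  exact lt_irrefl _ h

theorem zeckVal_of_zero {l : ℕ} {w : Fin (l + 1) → Fin 2} (h : ¬ w 0 = 1) :
    zeckVal (l + 1) w = zeckVal l (Fin.tail w) := by
  simp [zeckVal, h]

theorem zeckVal_of_one {l : ℕ} {w : Fin (l + 1) → Fin 2} (h : w 0 = 1) :
    zeckVal (l + 1) w = mW l + zeckVal l (Fin.tail w) := by
  simp [zeckVal, h]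

theorem mW_le_zeckVal_iff {l : ℕ} {w : Fin (l + 1) → Fin 2} (hw : DyckAdm (l + 1) w) :
    mW l ≤ zeckVal (l + 1) w ↔ w 0 = 1 := by
  by_cases h : w 0 = 1
  · simp [h, zeckVal_of_one h]
  · simp [h, zeckVal_of_zero h, zeckVal_lt (dyckAdm_tail hw)]

theorem zeckVal_inj {l : ℕ} {u w : Fin l → Fin 2} (hu : DyckAdm l u) (hw : DyckAdm l w) :
    zeckVal l u = zeckVal l w ↔ u = w := by
  refine ⟨fun h => ?_, fun h => h ▸ rfl⟩
  induction l with
  | zero => exact Subsingleton.elim _ _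
  | succ l ih =>
    have h1 : u 0 = 1 ↔ w 0 = 1 := by
      rw [← mW_le_zeckVal_iff hu, ← mW_le_zeckVal_iff hw, h]
    have h0 : u 0 = w 0 := by omega
    have ht : zeckVal l (Fin.tail u) = zeckVal l (Fin.tail w) := by
      simp only [zeckVal, h0] at h
      omega
    rw [← Fin.cons_self_tail u, ← Fin.cons_self_tail w, h0,
      ih (dyckAdm_tail hu) (dyckAdm_tail hw) ht]

theorem exists_zeckVal_eq {l i : ℕ} (hi : i < mW l) : ∃ w ∈ Wset l, zeckVal l w = i := by
  have := surj_on_of_inj_on_of_card_le (s := Wset l) (t := range (mW l))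
    (fun w _ => zeckVal l w) (fun w hw => mem_range.2 (zeckVal_lt (mem_Wset.1 hw)))
    (fun u w hu hw h => (zeckVal_inj (mem_Wset.1 hu) (mem_Wset.1 hw)).1 h)
    (by simp [mW]) i (mem_range.2 hi)
  obtain ⟨w, hw, h⟩ := this
  exact ⟨w, hw, h.symm⟩

/-- The map on 0-based positions induced by deleting the first letter of a word of
length `l + 1`. -/
def dropFirst (l i : ℕ) : ℕ := if i < mW l then i else i - mW l

/-- The map on 0-based positions induced by deleting the last letter of a word of
length `l + 1`. -/
def dropLast : ℕ → ℕ → ℕ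
  | 0, _ => 0
  | l + 1, i => if i < mW (l + 1) then dropLast l i else mW l + dropLast l (i - mW (l + 1))

theorem zeckVal_tail {l : ℕ} {w : Fin (l + 1) → Fin 2} (hw : DyckAdm (l + 1) w) :
    zeckVal l (Fin.tail w) = dropFirst l (zeckVal (l + 1) w) := by
  have hlt := zeckVal_lt (dyckAdm_tail hw)
  by_cases h : w 0 = 1
  · simp [dropFirst, zeckVal_of_one h]
  · simp [dropFirst, zeckVal_of_zero h, hlt]

theorem zeckVal_init {l : ℕ} {w : Fin (l + 1) → Fin 2} (hw : DyckAdm (l + 1) w) :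
    zeckVal l (Fin.init w) = dropLast l (zeckVal (l + 1) w) := by
  induction l with
  | zero => rfl
  | succ l ih =>
    have hlt := zeckVal_lt (dyckAdm_tail hw)
    have hz : Fin.init w 0 = w 0 := rfl
    have ht : Fin.tail (Fin.init w) = Fin.init (Fin.tail w) := Fin.tail_init_eq_init_tail w
    by_cases h : w 0 = 1
    · rw [zeckVal_of_one (hz.trans h), zeckVal_of_one h, ht, ih (dyckAdm_tail hw)]
      simp [dropLast]
    · rw [zeckVal_of_zero (hz ▸ h), zeckVal_of_zero h, ht, ih (dyckAdm_tail hw)]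
      simp [dropLast, hlt]

theorem dropLast_lt {l i : ℕ} (hi : i < mW (l + 1)) : dropLast l i < mW l := by
  obtain ⟨w, hw, rfl⟩ := exists_zeckVal_eq hi
  rw [mem_Wset] at hw
  rw [← zeckVal_init hw]
  exact zeckVal_lt (dyckAdm_init hw)

theorem Imat_apply {l : ℕ} {w : Fin l → Fin 2} {w' : Fin (l + 1) → Fin 2}
    (hw : w ∈ Wset l) (hw' : w' ∈ Wset (l + 1)) :
    Imat l (zeckVal l w + 1) (zeckVal (l + 1) w' + 1) = if Fin.init w' = w then 1 else 0 := by
  unfold Imat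
  refine if_congr ⟨?_, fun h => ⟨w, hw, w', hw', rankW_eq hw, rankW_eq hw', ?_⟩⟩ rfl rfl
  · rintro ⟨u, hu, u', hu', h, h', heq⟩
    rw [rankW_eq hu, add_left_inj, zeckVal_inj (mem_Wset.1 hu) (mem_Wset.1 hw)] at h
    rw [rankW_eq hu', add_left_inj, zeckVal_inj (mem_Wset.1 hu') (mem_Wset.1 hw')] at h'
    subst h h'
    exact funext fun k => (heq k).symm
  · subst h
    exact fun k => rfl

theorem Mmat_apply {l : ℕ} {w : Fin (l + 1) → Fin 2} {w' : Fin (l + 2) → Fin 2}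
    (hw : w ∈ Wset (l + 1)) (hw' : w' ∈ Wset (l + 2)) :
    Mmat (l + 1) (zeckVal (l + 1) w + 1) (zeckVal (l + 2) w' + 1) =
      (if Fin.tail w' = w then 1 else 0) +
        if ¬(w 0 = 1 ∧ w' 0 = 1) ∧ Fin.tail w = Fin.init (Fin.init w') then 1 else 0 := by
  have hrank : ∀ {n : ℕ} {u v : Fin n → Fin 2}, u ∈ Wset n → v ∈ Wset n →
      (rankW n u = zeckVal n v + 1 ↔ u = v) := by
    intro n u v hu hv
    rw [rankW_eq hu, add_left_inj, zeckVal_inj (mem_Wset.1 hu) (mem_Wset.1 hv)]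
  rw [Mmat, sum_eq_single_of_mem w hw, sum_eq_single_of_mem w' hw',
    if_pos ⟨rankW_eq hw, rankW_eq hw'⟩]
  · congr 1
    · exact if_congr funext_iff.symm rfl rfl
    · refine if_congr (and_congr_right fun _ => ⟨fun h => funext fun t => ?_, fun h t ht => ?_⟩)
        rfl rfl
      · exact h t.succ (by simp)
      · obtain ⟨s, rfl⟩ := Fin.exists_succ_eq.2 (fun h0 : t = 0 => ht (by simp [h0]))
        exact congrFun h s
  · intro u' hu' hne
    rw [if_neg]
    exact fun h => hne ((hrank hu' hw').1 h.2)
  · intro u hu hne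
    refine sum_eq_zero fun u' _ => ?_
    rw [if_neg]
    exact fun h => hne ((hrank hu hw).1 h.1)

/-- The map on 0-based positions induced by deleting the last two letters of a word of
length `l + 2`. -/
def dropLastTwo (l i : ℕ) : ℕ := dropLast l (dropLast (l + 1) i)

theorem AmatN_succ_apply {l i j : ℕ} (hi : i < mW (l + 2)) (hj : j < mW (l + 1)) :
    AmatN (l + 1) (i + 1) (j + 1) =
      (if dropFirst (l + 1) i = j then 1 else 0) +
        (if ¬(mW l ≤ j ∧ mW (l + 1) ≤ i) ∧ dropFirst l j = dropLastTwo l i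
          then 1 else 0) -
        if dropLast (l + 1) i = j then 1 else 0 := by
  obtain ⟨w', hw', rfl⟩ := exists_zeckVal_eq hi
  obtain ⟨w, hw, rfl⟩ := exists_zeckVal_eq hj
  rw [AmatN, Mmat_apply hw hw', Imat_apply hw hw']
  rw [mem_Wset] at hw hw'
  simp only [dropLastTwo, mW_le_zeckVal_iff hw, mW_le_zeckVal_iff hw', ← zeckVal_tail hw,
    ← zeckVal_tail hw', ← zeckVal_init hw', ← zeckVal_init (dyckAdm_init hw'),
    zeckVal_inj (dyckAdm_tail hw') hw,
    zeckVal_inj (dyckAdm_init hw') hw,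
    zeckVal_inj (dyckAdm_tail hw) (dyckAdm_init (dyckAdm_init hw'))]

theorem dropLastTwo_lt {l i : ℕ} (hi : i < mW (l + 2)) : dropLastTwo l i < mW l :=
  dropLast_lt (dropLast_lt hi)

theorem dropLast_succ_of_lt {l i : ℕ} (hi : i < mW (l + 1)) :
    dropLast (l + 1) i = dropLast l i := by
  simp [dropLast, hi]

theorem dropLast_succ_of_le {l i : ℕ} (hi : mW (l + 1) ≤ i) :
    dropLast (l + 1) i = mW l + dropLast l (i - mW (l + 1)) := by
  simp [dropLast, hi.not_gt]

theorem dropLastTwo_succ_of_lt {l i : ℕ} (hi : i < mW (l + 2)) :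
    dropLastTwo (l + 1) i = dropLastTwo l i := by
  rw [dropLastTwo, dropLast_succ_of_lt hi, dropLast_succ_of_lt (dropLast_lt hi), dropLastTwo]

theorem dropLastTwo_succ_of_le {l i : ℕ} (hi : mW (l + 2) ≤ i) :
    dropLastTwo (l + 1) i = mW l + dropLastTwo l (i - mW (l + 2)) := by
  rw [dropLastTwo, dropLast_succ_of_le hi, dropLast_succ_of_le (Nat.le_add_right _ _),
    Nat.add_sub_cancel_left, dropLastTwo]

theorem dropLast_succ_mW_add (l i : ℕ) :
    dropLast (l + 1) (mW (l + 1) + i) = mW l + dropLast l i := by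
  rw [dropLast_succ_of_le (Nat.le_add_right _ _), Nat.add_sub_cancel_left]

theorem dropLastTwo_succ_mW_add (l i : ℕ) :
    dropLastTwo (l + 1) (mW (l + 2) + i) = mW l + dropLastTwo l i := by
  rw [dropLastTwo_succ_of_le (Nat.le_add_right _ _), Nat.add_sub_cancel_left]

theorem Smat_succ_apply (l : ℕ) {i j : ℕ} (hi : i < mW l) (hj : j < mW (l + 2)) :
    Smat (l + 1) (i + 1) (j + 1) = if dropLastTwo l j = i then 1 else 0 := by
  induction l using Nat.twoStepInduction generalizing i j with
  | zero =>
    have := mW_add_two 0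
    simp only [mW_zero, mW_one, zero_add] at *
    simp [Smat, dropLastTwo, dropLast]
    omega
  | one =>
    have h2 := mW_add_two 0
    have h3 := mW_add_two 1
    simp only [mW_zero, mW_one, zero_add, Nat.reduceAdd] at *
    have := @dropLastTwo_succ_of_lt 0 j
    have := @dropLastTwo_succ_of_le 0 j
    simp only [mW_zero, zero_add, Nat.reduceAdd, dropLastTwo, dropLast] at *
    simp only [Smat, mW_zero, zero_add]
    grind
  | more l ih1 ih2 =>
    have h2 := mW_add_two l
    have h3 := mW_add_two (l + 1)
    have h4 := mW_add_two (l + 2)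
    have hS : Smat (l + 3) (i + 1) (j + 1) =
        if i + 1 ≤ mW (l + 1) then (if j + 1 ≤ mW (l + 3) then Smat (l + 2) (i + 1) (j + 1) else 0)
        else if j + 1 ≤ mW (l + 3) then 0
        else Smat (l + 1) (i + 1 - mW (l + 1)) (j + 1 - mW (l + 3)) := rfl
    simp only [Nat.add_assoc, Nat.reduceAdd] at *
    rw [hS]
    by_cases hj' : j < mW (l + 3)
    · have hlt : dropLastTwo (l + 1) j < mW (l + 1) := dropLastTwo_lt hj'
      have hd : dropLastTwo (l + 2) j = dropLastTwo (l + 1) j := dropLastTwo_succ_of_lt hj'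
      rw [hd, if_pos (Nat.succ_le_of_lt hj')]
      by_cases hi' : i < mW (l + 1)
      · rw [if_pos (Nat.succ_le_of_lt hi'), ih2 hi' hj']
      · rw [if_neg (by omega), if_pos (by omega), if_neg (by omega)]
    · have hd : dropLastTwo (l + 2) j = mW (l + 1) + dropLastTwo (l + 1) (j - mW (l + 3)) :=
        dropLastTwo_succ_of_le (not_lt.1 hj')
      have hj2 : j - mW (l + 3) < mW (l + 2) := by omega
      rw [hd, dropLastTwo_succ_of_lt hj2, if_neg (by omega : ¬ j + 1 ≤ mW (l + 3))]
      by_cases hi' : i < mW (l + 1)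
      · rw [if_pos (Nat.succ_le_of_lt hi'), if_neg (by omega)]
      · rw [if_neg (by omega), if_neg (by omega), Nat.sub_add_comm (by omega),
          Nat.sub_add_comm (by omega), ih1 (by omega) hj2]
        exact if_congr (by omega) rfl rfl

theorem AmatN_upperLeft (n : ℕ) :
    ∀ i j : ℕ, 1 ≤ i → i ≤ mW (n + 4) → 1 ≤ j → j ≤ mW (n + 3) →
      ((i ≤ mW (n + 3) ∧ j ≤ mW (n + 2)) → AmatN (n + 4) i j = AmatN (n + 3) i j) ∧
      ((i ≤ mW (n + 2) ∧ mW (n + 2) < j) → AmatN (n + 4) i j = 0) ∧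
      ((mW (n + 2) < i ∧ i ≤ mW (n + 3) ∧ mW (n + 2) < j) →
          AmatN (n + 4) i j = if i = j then 1 else 0) ∧
      ((mW (n + 3) < i ∧ j ≤ mW (n + 1)) → AmatN (n + 4) i j = 0) ∧
      ((mW (n + 3) < i ∧ mW (n + 1) < j ∧ j ≤ mW (n + 1) + mW n) →
          AmatN (n + 4) i j = Smat (n + 1) (j - mW (n + 1)) (i - mW (n + 3))) ∧
      ((mW (n + 3) < i ∧ mW (n + 1) + mW n < j) → AmatN (n + 4) i j = AmatN (n + 3) i j) := by
  have h2 := mW_add_two n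
  have h3 : mW (n + 3) = mW (n + 2) + mW (n + 1) := mW_add_two (n + 1)
  have h4 : mW (n + 4) = mW (n + 3) + mW (n + 2) := mW_add_two (n + 2)
  have h5 : mW (n + 5) = mW (n + 4) + mW (n + 3) := mW_add_two (n + 3)
  intro i j hi1 hi hj1 hj
  obtain ⟨i, rfl⟩ := Nat.exists_eq_add_of_le' hi1
  obtain ⟨j, rfl⟩ := Nat.exists_eq_add_of_le' hj1
  rw [AmatN_succ_apply (l := n + 3) (show _ < mW (n + 5) by omega)
      (show _ < mW (n + 4) by omega),
    AmatN_succ_apply (l := n + 2) (show _ < mW (n + 4) by omega)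
      (show _ < mW (n + 3) by omega), dropLast_succ_of_lt (l := n + 3) hi,
    dropLastTwo_succ_of_lt (l := n + 2) hi]
  simp only [Nat.add_assoc, Nat.reduceAdd, dropFirst] at *
  by_cases hi3 : i < mW (n + 3)
  · rw [dropLast_succ_of_lt (l := n + 2) hi3, dropLastTwo_succ_of_lt (l := n + 1) hi3]
    have hlt : dropLast (n + 2) i < mW (n + 2) := dropLast_lt hi3
    have hlt_of_lt : i < mW (n + 2) → dropLast (n + 2) i < mW (n + 1) := fun h =>
      (dropLast_succ_of_lt h).trans_lt (dropLast_lt h)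
    have hlt2 : dropLastTwo (n + 1) i < mW (n + 1) := dropLastTwo_lt hi3
    refine ⟨?_, ?_, ?_, ?_, ?_, ?_⟩ <;> intro h <;> first | omega | grind
  · obtain ⟨i, rfl⟩ := Nat.exists_eq_add_of_le (not_lt.1 hi3)
    have hi2 : i < mW (n + 2) := by omega
    rw [dropLast_succ_mW_add (n + 2), dropLastTwo_succ_mW_add (n + 1), dropLastTwo_succ_of_lt hi2]
    have hlt2 : dropLastTwo n i < mW n := dropLastTwo_lt hi2
    refine ⟨?_, ?_, ?_, ?_, ?_, ?_⟩ <;> intro h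
    · omega
    · omega
    · omega
    · grind
    · obtain ⟨k, rfl⟩ : ∃ k, j = mW (n + 1) + k := Nat.exists_eq_add_of_le (by omega)
      rw [show mW (n + 1) + k + 1 - mW (n + 1) = k + 1 by omega,
        show mW (n + 3) + i + 1 - mW (n + 3) = i + 1 by omega,
        Smat_succ_apply n (by omega) hi2]
      grind
    · grind

theorem AmatN_upperRight (n : ℕ) :
    ∀ i j : ℕ, 1 ≤ i → i ≤ mW (n + 4) → 1 ≤ j → j ≤ mW (n + 2) →
      ((i ≤ mW (n + 3) ∧ j ≤ mW (n + 1)) →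
          AmatN (n + 4) i (mW (n + 3) + j) = Smat (n + 2) j i) ∧
      ((i ≤ mW (n + 3) ∧ mW (n + 1) < j) → AmatN (n + 4) i (mW (n + 3) + j) = 0) ∧
      (mW (n + 3) < i → AmatN (n + 4) i (mW (n + 3) + j) = AmatN (n + 3) i j) := by
  have h3 : mW (n + 3) = mW (n + 2) + mW (n + 1) := mW_add_two (n + 1)
  have h4 : mW (n + 4) = mW (n + 3) + mW (n + 2) := mW_add_two (n + 2)
  have h5 : mW (n + 5) = mW (n + 4) + mW (n + 3) := mW_add_two (n + 3)
  intro i j hi1 hi hj1 hj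
  obtain ⟨i, rfl⟩ := Nat.exists_eq_add_of_le' hi1
  obtain ⟨j, rfl⟩ := Nat.exists_eq_add_of_le' hj1
  rw [← add_assoc, AmatN_succ_apply (l := n + 3) (show _ < mW (n + 5) by omega)
      (show _ < mW (n + 4) by omega),
    AmatN_succ_apply (l := n + 2) (show _ < mW (n + 4) by omega)
      (show _ < mW (n + 3) by omega), dropLast_succ_of_lt (l := n + 3) hi,
    dropLastTwo_succ_of_lt (l := n + 2) hi]
  simp only [Nat.add_assoc, Nat.reduceAdd, dropFirst] at *
  have hlt : dropLast (n + 3) i < mW (n + 3) := dropLast_lt hi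
  refine ⟨fun h => ?_, fun h => ?_, fun h => ?_⟩
  · rw [Smat_succ_apply (n + 1) (by omega) h.1, dropLastTwo_succ_of_lt (l := n + 1) h.1]
    grind
  · rw [dropLastTwo_succ_of_lt (l := n + 1) h.1]
    have hlt2 : dropLastTwo (n + 1) i < mW (n + 1) := dropLastTwo_lt h.1
    grind
  · obtain ⟨i, rfl⟩ := Nat.exists_eq_add_of_le (Nat.le_of_lt_succ h)
    rw [dropLast_succ_mW_add (n + 2)] at *
    grind

theorem AmatN_lowerLeft (n : ℕ) :
    ∀ i j : ℕ, 1 ≤ i → i ≤ mW (n + 3) → 1 ≤ j → j ≤ mW (n + 3) →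
      ((j ≤ mW (n + 2) ∧ i ≤ mW (n + 2)) →
          AmatN (n + 4) (mW (n + 4) + i) j = if i = j then 1 else 0) ∧
      ((j ≤ mW (n + 2) ∧ mW (n + 2) < i) → AmatN (n + 4) (mW (n + 4) + i) j = 0) ∧
      (mW (n + 2) < j → AmatN (n + 4) (mW (n + 4) + i) j = AmatN (n + 3) i j) := by
  have h3 : mW (n + 3) = mW (n + 2) + mW (n + 1) := mW_add_two (n + 1)
  have h4 : mW (n + 4) = mW (n + 3) + mW (n + 2) := mW_add_two (n + 2)
  have h5 : mW (n + 5) = mW (n + 4) + mW (n + 3) := mW_add_two (n + 3)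
  intro i j hi1 hi hj1 hj
  obtain ⟨i, rfl⟩ := Nat.exists_eq_add_of_le' hi1
  obtain ⟨j, rfl⟩ := Nat.exists_eq_add_of_le' hj1
  rw [← add_assoc, AmatN_succ_apply (l := n + 3) (show _ < mW (n + 5) by omega)
      (show _ < mW (n + 4) by omega),
    AmatN_succ_apply (l := n + 2) (show _ < mW (n + 4) by omega)
      (show _ < mW (n + 3) by omega), dropLast_succ_mW_add (n + 3),
    dropLastTwo_succ_mW_add (n + 2), dropLast_succ_of_lt (l := n + 2) hi]
  simp only [Nat.add_assoc, Nat.reduceAdd, dropFirst] at *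
  have hlt : dropLast (n + 2) i < mW (n + 2) := dropLast_lt hi
  refine ⟨fun h => ?_, fun h => ?_, fun h => ?_⟩ <;> grind

theorem AmatN_lowerRight (n : ℕ) :
    ∀ i j : ℕ, 1 ≤ i → i ≤ mW (n + 3) → 1 ≤ j → j ≤ mW (n + 2) →
      ((i ≤ mW (n + 2) ∧ j ≤ mW (n + 1)) →
          AmatN (n + 4) (mW (n + 4) + i) (mW (n + 3) + j) =
            AmatN (n + 3) (mW (n + 3) + i) (mW (n + 2) + j)) ∧
      ((i ≤ mW (n + 2) ∧ mW (n + 1) < j) →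
          AmatN (n + 4) (mW (n + 4) + i) (mW (n + 3) + j) = 0) ∧
      ((mW (n + 2) < i ∧ j ≤ mW (n + 1)) →
          AmatN (n + 4) (mW (n + 4) + i) (mW (n + 3) + j) = 0) ∧
      ((mW (n + 2) < i ∧ mW (n + 1) < j) →
          AmatN (n + 4) (mW (n + 4) + i) (mW (n + 3) + j) = AmatN (n + 2) i j) := by
  have h2 := mW_add_two n
  have h3 : mW (n + 3) = mW (n + 2) + mW (n + 1) := mW_add_two (n + 1)
  have h4 : mW (n + 4) = mW (n + 3) + mW (n + 2) := mW_add_two (n + 2)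
  have h5 : mW (n + 5) = mW (n + 4) + mW (n + 3) := mW_add_two (n + 3)
  intro i j hi1 hi hj1 hj
  obtain ⟨i, rfl⟩ := Nat.exists_eq_add_of_le' hi1
  obtain ⟨j, rfl⟩ := Nat.exists_eq_add_of_le' hj1
  simp only [← add_assoc]
  rw [AmatN_succ_apply (l := n + 3) (show _ < mW (n + 5) by omega)
      (show _ < mW (n + 4) by omega),
    AmatN_succ_apply (l := n + 1) (show _ < mW (n + 3) by omega)
      (show _ < mW (n + 2) by omega), dropLast_succ_mW_add (n + 3),
    dropLast_succ_of_lt (l := n + 2) hi]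
  simp only [Nat.add_assoc n, Nat.reduceAdd, dropFirst] at *
  have hlt : dropLast (n + 2) i < mW (n + 2) := dropLast_lt hi
  have hlt_of_lt : i < mW (n + 2) → dropLast (n + 2) i < mW (n + 1) := fun h =>
    (dropLast_succ_of_lt h).trans_lt (dropLast_lt h)
  refine ⟨fun h => ?_, fun h => ?_, fun h => ?_, fun h => ?_⟩
  · rw [AmatN_succ_apply (l := n + 2) (show _ < mW (n + 4) by omega)
      (show _ < mW (n + 3) by omega), dropLast_succ_mW_add (n + 2), dropFirst]
    grind
  · grind
  · have hle : mW (n + 1) ≤ dropLast (n + 2) i :=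
      (Nat.le_add_right _ _).trans_eq (dropLast_succ_of_le (Nat.le_of_lt_succ h.1)).symm
    grind
  · grind

/-- the block recursions for `𝔸_{l+2,l+1}` in terms of the blocks of
`𝔸_{l+1,l}` (and `𝔸_{l,l-1}`), for every `l ≥ 3`.  Here `𝔸_{l+1,l}` (`= AmatN l`) is
written in block form with `𝔸^{UL}` of size `m(l) × m(l-1)`, `𝔸^{UR}` of size
`m(l) × m(l-2)`, `𝔸^{LL}` of size `m(l-1) × m(l-1)`, `𝔸^{LR}` of size `m(l-1) × m(l-2)`,
and all statements are expressed entrywise through the ambient matrix. -/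
theorem AmatN_block_recursion (l : ℕ) (hl : 3 ≤ l) :
    -- (a) the block 𝔸^{UL}_{l+2,l+1} (rows 1..m(l+1), columns 1..m(l) of 𝔸_{l+2,l+1})
    (∀ i j : ℕ, 1 ≤ i → i ≤ mW (l + 1) → 1 ≤ j → j ≤ mW l →
      ((i ≤ mW l ∧ j ≤ mW (l - 1)) → AmatN (l + 1) i j = AmatN l i j) ∧
      ((i ≤ mW (l - 1) ∧ mW (l - 1) < j) → AmatN (l + 1) i j = 0) ∧
      ((mW (l - 1) < i ∧ i ≤ mW l ∧ mW (l - 1) < j) →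
          AmatN (l + 1) i j = if i = j then 1 else 0) ∧
      ((mW l < i ∧ j ≤ mW (l - 2)) → AmatN (l + 1) i j = 0) ∧
      ((mW l < i ∧ mW (l - 2) < j ∧ j ≤ mW (l - 2) + mW (l - 3)) →
          AmatN (l + 1) i j = Smat (l - 2) (j - mW (l - 2)) (i - mW l)) ∧
      ((mW l < i ∧ mW (l - 2) + mW (l - 3) < j) → AmatN (l + 1) i j = AmatN l i j)) ∧
    -- (b) the block 𝔸^{UR}_{l+2,l+1} (rows 1..m(l+1), columns m(l)+1..m(l)+m(l-1))
    (∀ i j : ℕ, 1 ≤ i → i ≤ mW (l + 1) → 1 ≤ j → j ≤ mW (l - 1) →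
      ((i ≤ mW l ∧ j ≤ mW (l - 2)) → AmatN (l + 1) i (mW l + j) = Smat (l - 1) j i) ∧
      ((i ≤ mW l ∧ mW (l - 2) < j) → AmatN (l + 1) i (mW l + j) = 0) ∧
      (mW l < i → AmatN (l + 1) i (mW l + j) = AmatN l i j)) ∧
    -- (c) the block 𝔸^{LL}_{l+2,l+1} (rows m(l+1)+1..m(l+2), columns 1..m(l))
    (∀ i j : ℕ, 1 ≤ i → i ≤ mW l → 1 ≤ j → j ≤ mW l →
      ((j ≤ mW (l - 1) ∧ i ≤ mW (l - 1)) →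
          AmatN (l + 1) (mW (l + 1) + i) j = if i = j then 1 else 0) ∧
      ((j ≤ mW (l - 1) ∧ mW (l - 1) < i) → AmatN (l + 1) (mW (l + 1) + i) j = 0) ∧
      (mW (l - 1) < j → AmatN (l + 1) (mW (l + 1) + i) j = AmatN l i j)) ∧
    -- (d) the block 𝔸^{LR}_{l+2,l+1} (rows m(l+1)+1..m(l+2), columns m(l)+1..m(l)+m(l-1))
    (∀ i j : ℕ, 1 ≤ i → i ≤ mW l → 1 ≤ j → j ≤ mW (l - 1) →
      ((i ≤ mW (l - 1) ∧ j ≤ mW (l - 2)) →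
          AmatN (l + 1) (mW (l + 1) + i) (mW l + j) = AmatN l (mW l + i) (mW (l - 1) + j)) ∧
      ((i ≤ mW (l - 1) ∧ mW (l - 2) < j) →
          AmatN (l + 1) (mW (l + 1) + i) (mW l + j) = 0) ∧
      ((mW (l - 1) < i ∧ j ≤ mW (l - 2)) →
          AmatN (l + 1) (mW (l + 1) + i) (mW l + j) = 0) ∧
      ((mW (l - 1) < i ∧ mW (l - 2) < j) →
          AmatN (l + 1) (mW (l + 1) + i) (mW l + j) = AmatN (l - 1) i j)) := by
  obtain ⟨n, rfl⟩ := Nat.exists_eq_add_of_le' hl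
  exact ⟨AmatN_upperLeft n, AmatN_upperRight n, AmatN_lowerLeft n, AmatN_lowerRight n⟩
end
end

section
/- For every l ≥ 2, the cokernel ℤ^{m(l)}/ℍ_{l,l−1}ℤ^{m(l−1)} of the ℤ-linear map given by the matrix ℍ_{l,l−1} is isomorphic to ℤ^{m(l−2)+1}/R_{m(l−2)}ℤ, where R_{m(l−2)} = (2,−1,…,−1) ∈ ℤ^{m(l−2)+1}; in particular it is a free abelian group of rank m(l−2). -/
noncomputable section



open Finset

/-- The vectors `v_l ∈ ℤ^{m(l-1)}` (1-based entries): `v_1 = (-3)`, `v_2 = (-3,-3)`;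
for `l ≥ 3`, `v_l(i) = -3` if `l ≡ 1, 2 (mod 4)` and `v_l(i) = 3` if `l ≡ 3, 0 (mod 4)`
for `1 ≤ i ≤ m(l-2)`, and `v_l(m(l-2)+i) = v_{l-2}(i) ∓ 4` (sign so as to decrease the
absolute value) for `1 ≤ i ≤ m(l-3)`. -/
def vv : ℕ → ℕ → ℤ
  | 0, _ => 0
  | 1, i => if i = 1 then -3 else 0
  | 2, i => if 1 ≤ i ∧ i ≤ 2 then -3 else 0
  | (l + 3), i =>
      if 1 ≤ i ∧ i ≤ mW (l + 1) then
        (if (l + 3) % 4 = 1 ∨ (l + 3) % 4 = 2 then -3 else 3)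
      else if mW (l + 1) < i ∧ i ≤ mW (l + 1) + mW l then
        (if 0 < vv (l + 1) (i - mW (l + 1)) then vv (l + 1) (i - mW (l + 1)) - 4
         else vv (l + 1) (i - mW (l + 1)) + 4)
      else 0

/-- The matrix `𝒩_{l+1,l}` (1-based indices, size `m(l+1) × m(l)`). -/
def Nmat (l : ℕ) : ℕ → ℕ → ℤ := fun i j =>
  if 1 ≤ j ∧ j ≤ mW l ∧ 1 ≤ i ∧ i ≤ mW (l + 1) then
    (if i = j ∧ i < mW l then 1
     else if i = j ∧ i = mW l then 2
     else if mW l < i ∧ j = mW l then vv l (i - mW l)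
     else 0)
  else 0

/-- The matrix `ℍ_{l+1,l}` (1-based indices, size `m(l+1) × m(l)`). -/
def Hmat (l : ℕ) : ℕ → ℕ → ℤ := fun i j =>
  if 1 ≤ j ∧ j ≤ mW l ∧ 1 ≤ i ∧ i ≤ mW (l + 1) then
    (if i = j ∧ i < mW l then 1
     else if i = j ∧ i = mW l then 2
     else if mW l < i ∧ j = mW l then -1
     else 0)
  else 0

/-- `ℍ_{l+1,l}` as an additive map `ℤ^{m(l)} → ℤ^{m(l+1)}`. -/
def Hadd (l : ℕ) : (Fin (mW l) → ℤ) →+ (Fin (mW (l + 1)) → ℤ) :=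
  (Matrix.mulVecLin
    (fun (i : Fin (mW (l + 1))) (j : Fin (mW l)) => Hmat l ((i : ℕ) + 1) ((j : ℕ) + 1))).toAddMonoidHom

/-- The vector `R_n = (2, -1, …, -1) ∈ ℤ^{n+1}`. -/
def Rvec (n : ℕ) : Fin (n + 1) → ℤ := fun i => if i = 0 then 2 else -1

theorem dyckAdm_cons_zero_iff (l : ℕ) (w : Fin l → Fin 2) :
    DyckAdm (l + 1) (Fin.cons 0 w) ↔ DyckAdm l w := by
  constructor
  · intro h i j hij
    simpa using h i.succ j.succ (by simp [hij])
  · intro h i j hij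
    refine Fin.cases ?_ (fun i => ?_) i j hij
    · intro j _
      simp
    · intro j
      refine Fin.cases (by simp) (fun j hij => ?_) j
      simpa using h i j (by simpa using hij)

theorem dyckAdm_cons_one_cons_zero_iff (l : ℕ) (w : Fin l → Fin 2) :
    DyckAdm (l + 2) (Fin.cons 1 (Fin.cons 0 w : Fin (l + 1) → Fin 2)) ↔ DyckAdm l w := by
  rw [← dyckAdm_cons_zero_iff l w]
  constructor
  · intro h i j hij
    simpa using h i.succ j.succ (by simp [hij])
  · intro h i j hij
    refine Fin.cases ?_ (fun i => ?_) i j hij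
    · intro j hj
      obtain rfl : j = Fin.succ 0 := Fin.ext (by simpa using hj)
      simp
    · intro j
      refine Fin.cases (by simp) (fun j hij => ?_) j
      simpa using h i j (by simpa using hij)

theorem Wset_add_two (l : ℕ) :
    Wset (l + 2) =
      (Wset (l + 1)).image (fun w => (Fin.cons 0 w : Fin (l + 2) → Fin 2)) ∪
      (Wset l).image (fun w =>
        (Fin.cons 1 (Fin.cons 0 w : Fin (l + 1) → Fin 2) : Fin (l + 2) → Fin 2)) := by
  ext w
  simp only [Wset, mem_union, mem_image, mem_filter, mem_univ, true_and]
  constructor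
  · intro h
    obtain h0 | h0 : w 0 = 0 ∨ w 0 = 1 := by omega
    · have hw : Fin.cons 0 (Fin.tail w) = w := by rw [← h0, Fin.cons_self_tail]
      exact Or.inl ⟨Fin.tail w, by rwa [← dyckAdm_cons_zero_iff, hw], hw⟩
    · have h1 : w 1 = 0 := by
        have := h 0 1 (by simp)
        omega
      have hw : Fin.cons 1 (Fin.cons 0 (Fin.tail (Fin.tail w)) : Fin (l + 1) → Fin 2) = w := by
        have h1' : Fin.tail w 0 = 0 := h1
        rw [← h1', Fin.cons_self_tail, ← h0, Fin.cons_self_tail]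
      exact Or.inr ⟨Fin.tail (Fin.tail w), by rwa [← dyckAdm_cons_one_cons_zero_iff, hw], hw⟩
  · rintro (⟨u, hu, rfl⟩ | ⟨u, hu, rfl⟩)
    · rwa [dyckAdm_cons_zero_iff]
    · rwa [dyckAdm_cons_one_cons_zero_iff]

theorem mW_pos (l : ℕ) : 0 < mW l :=
  card_pos.2 ⟨fun _ => 0, by simp [Wset, DyckAdm]⟩

theorem Hadd_apply (l : ℕ) (k : Fin (mW l)) (hk : (k : ℕ) + 1 = mW l)
    (x : Fin (mW l) → ℤ) (i : Fin (mW (l + 1))) :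
    Hadd l x i =
      if h : (i : ℕ) < k then x ⟨i, h.trans k.isLt⟩ else if (i : ℕ) = k then 2 * x k else -x k := by
  change ∑ j : Fin (mW l), Hmat l ((i : ℕ) + 1) ((j : ℕ) + 1) * x j = _
  split_ifs with h h'
  · rw [sum_eq_single ⟨i, h.trans k.isLt⟩ _ (by simp)]
    · rw [Hmat, if_pos (by dsimp only; omega), if_pos (by dsimp only; omega), one_mul]
    · intro j _ hj
      have : (j : ℕ) ≠ i := fun e => hj (Fin.ext e)
      have : Hmat l ((i : ℕ) + 1) ((j : ℕ) + 1) = 0 := by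
        rw [Hmat, if_pos (by omega), if_neg (by omega), if_neg (by omega), if_neg (by omega)]
      rw [this, zero_mul]
  all_goals
    rw [sum_eq_single k _ (by simp)]
    · rw [Hmat, if_pos (by omega), if_neg (by omega)]
      first
      | rw [if_pos (by omega)]
      | rw [if_neg (by omega), if_pos (by omega), neg_one_mul]
    · intro j _ hj
      have : (j : ℕ) ≠ k := fun e => hj (Fin.ext e)
      have : Hmat l ((i : ℕ) + 1) ((j : ℕ) + 1) = 0 := by
        rw [Hmat, if_pos (by omega), if_neg (by omega), if_neg (by omega), if_neg (by omega)]
      rw [this, zero_mul]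

/-- Projection of `ℤ^{m(n+2)}` onto its last `m(n) + 1` coordinates. -/
def lastCoords (n : ℕ) : (Fin (mW (n + 2)) → ℤ) →+ (Fin (mW n + 1) → ℤ) where
  toFun x i := x ⟨mW (n + 1) - 1 + i, by
    have := mW_add_two n
    have := mW_pos (n + 1)
    omega⟩
  map_zero' := rfl
  map_add' _ _ := rfl

theorem lastCoords_surjective (n : ℕ) : Function.Surjective (lastCoords n) := by
  intro y
  refine ⟨fun i => if h : (i : ℕ) - (mW (n + 1) - 1) < mW n + 1 then y ⟨_, h⟩ else 0, ?_⟩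
  ext i
  have hi := i.isLt
  simp only [lastCoords, AddMonoidHom.coe_mk, ZeroHom.coe_mk]
  rw [dif_pos (by omega)]
  exact congrArg y (Fin.ext (Nat.add_sub_cancel_left ..))

theorem Hadd_range_eq_comap (n : ℕ) :
    (Hadd (n + 1)).range =
      (AddSubgroup.zmultiples (Rvec (mW n))).comap (lastCoords n) := by
  have hm := mW_add_two n
  have hpos := mW_pos (n + 1)
  have hH := Hadd_apply (n + 1) ⟨mW (n + 1) - 1, by omega⟩ (by dsimp only; omega)
  ext x
  rw [AddSubgroup.mem_comap, AddSubgroup.mem_zmultiples_iff, AddMonoidHom.mem_range]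
  constructor
  · rintro ⟨z, rfl⟩
    refine ⟨z ⟨mW (n + 1) - 1, by omega⟩, ?_⟩
    ext i
    simp only [lastCoords, AddMonoidHom.coe_mk, ZeroHom.coe_mk, hH]
    rw [dif_neg (by omega)]
    by_cases hi : i = 0
    · simp [hi, Rvec, mul_comm]
    · have : (i : ℕ) ≠ 0 := fun e => hi (Fin.ext e)
      rw [if_neg (by omega)]
      simp [hi, Rvec]
  · rintro ⟨t, ht⟩
    refine ⟨fun j => if (j : ℕ) = mW (n + 1) - 1 then t
      else x ⟨j, j.isLt.trans_le (hm ▸ Nat.le_add_right ..)⟩, ?_⟩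
    ext i
    rw [hH]
    dsimp only
    rcases lt_trichotomy (i : ℕ) (mW (n + 1) - 1) with h | h | h
    · rw [dif_pos h, if_neg h.ne]
    · have := congrFun ht 0
      simp only [lastCoords, AddMonoidHom.coe_mk, ZeroHom.coe_mk, Pi.smul_apply, Rvec,
        if_true, smul_eq_mul] at this
      rw [dif_neg h.not_lt, if_pos h, if_pos rfl, mul_comm, this]
      exact congrArg x (Fin.ext h.symm)
    · have hilt : (i : ℕ) < mW (n + 2) := i.isLt
      have hi : (i : ℕ) - (mW (n + 1) - 1) < mW n + 1 := by omega
      have := congrFun ht ⟨_, hi⟩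
      simp only [lastCoords, AddMonoidHom.coe_mk, ZeroHom.coe_mk, Pi.smul_apply, Rvec,
        smul_eq_mul] at this
      rw [if_neg (by rw [Fin.ext_iff]; simp only [Fin.val_zero]; omega), mul_neg_one] at this
      rw [dif_neg h.not_gt, if_neg h.ne', if_pos rfl, this]
      exact congrArg x (Fin.ext (by dsimp only; omega))

/-- A surjection `ℤ^{c+2} → ℤ^{c+1}` whose kernel is generated by `R_{c+1}`. -/
def killRvec (c : ℕ) : (Fin (c + 2) → ℤ) →+ (Fin (c + 1) → ℤ) where
  toFun y := Fin.cons (y 0 + 2 * y 1) (fun i : Fin c => y i.succ.succ - y 1)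
  map_zero' := by
    ext i
    refine Fin.cases ?_ (fun i => ?_) i <;> simp
  map_add' y z := by
    ext i
    refine Fin.cases ?_ (fun i => ?_) i
    · simp only [Pi.add_apply, Fin.cons_zero]
      ring
    · simp only [Pi.add_apply, Fin.cons_succ]
      ring

theorem killRvec_surjective (c : ℕ) : Function.Surjective (killRvec c) := by
  intro z
  refine ⟨Fin.cons (z 0) (Fin.cons 0 (Fin.tail z) : Fin (c + 1) → ℤ), ?_⟩
  ext i
  refine Fin.cases ?_ (fun i => ?_) i
  · change z 0 + 2 * 0 = z 0
    ring
  · exact sub_zero (z i.succ)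

theorem killRvec_ker (c : ℕ) :
    (killRvec c).ker = AddSubgroup.zmultiples (Rvec (c + 1)) := by
  ext y
  rw [AddMonoidHom.mem_ker, AddSubgroup.mem_zmultiples_iff]
  constructor
  · intro h
    refine ⟨-y 1, ?_⟩
    ext i
    refine Fin.cases ?_ (fun i => ?_) i
    · have := congrFun h 0
      simp only [killRvec, AddMonoidHom.coe_mk, ZeroHom.coe_mk, Fin.cons_zero,
        Pi.zero_apply] at this
      simp only [Pi.smul_apply, Rvec, if_true, smul_eq_mul]
      linarith
    · refine Fin.cases ?_ (fun i => ?_) i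
      · simp [Rvec]
      · have := congrFun h i.succ
        simp only [killRvec, AddMonoidHom.coe_mk, ZeroHom.coe_mk, Fin.cons_succ,
          Pi.zero_apply] at this
        simp only [Pi.smul_apply, Rvec, Fin.succ_ne_zero, if_false, smul_eq_mul]
        linarith
  · rintro ⟨t, rfl⟩
    ext i
    refine Fin.cases ?_ (fun i => ?_) i
    · simp [killRvec, Rvec]
      ring
    · simp [killRvec, Rvec]

theorem nonempty_quotient_Rvec_addEquiv {b : ℕ} (hb : 0 < b) :
    Nonempty (((Fin (b + 1) → ℤ) ⧸ AddSubgroup.zmultiples (Rvec b)) ≃+ (Fin b → ℤ)) := by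
  obtain ⟨c, rfl⟩ := Nat.exists_eq_succ_of_ne_zero hb.ne'
  exact ⟨(QuotientAddGroup.quotientAddEquivOfEq (killRvec_ker c).symm).trans
    (QuotientAddGroup.quotientKerEquivOfSurjective _ (killRvec_surjective c))⟩

theorem nonempty_coker_Hadd_addEquiv (n : ℕ) :
    Nonempty (((Fin (mW (n + 2)) → ℤ) ⧸ (Hadd (n + 1)).range) ≃+
      ((Fin (mW n + 1) → ℤ) ⧸ AddSubgroup.zmultiples (Rvec (mW n)))) := by
  let p := (QuotientAddGroup.mk' (AddSubgroup.zmultiples (Rvec (mW n)))).comp (lastCoords n)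
  have hp : Function.Surjective p :=
    (QuotientAddGroup.mk'_surjective _).comp (lastCoords_surjective n)
  have hker : (Hadd (n + 1)).range = p.ker := by
    rw [Hadd_range_eq_comap, ← AddMonoidHom.comap_ker, QuotientAddGroup.ker_mk']
  exact ⟨(QuotientAddGroup.quotientAddEquivOfEq hker).trans
    (QuotientAddGroup.quotientKerEquivOfSurjective p hp)⟩

/-- for every `l ≥ 2` (here `l = n + 2`), the cokernel
`ℤ^{m(l)}/ℍ_{l,l-1}ℤ^{m(l-1)}` is isomorphic to `ℤ^{m(l-2)+1}/R_{m(l-2)}ℤ`;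
in particular it is free abelian of rank `m(l-2)`. -/
theorem coker_Hmat_iso (n : ℕ) :
    Nonempty ((((Fin (mW (n + 2)) → ℤ) ⧸ (Hadd (n + 1)).range)) ≃+
        ((Fin (mW n + 1) → ℤ) ⧸ AddSubgroup.zmultiples (Rvec (mW n)))) ∧
    Nonempty ((((Fin (mW (n + 2)) → ℤ) ⧸ (Hadd (n + 1)).range)) ≃+ (Fin (mW n) → ℤ)) := by
  obtain ⟨e⟩ := nonempty_coker_Hadd_addEquiv n
  obtain ⟨f⟩ := nonempty_quotient_Rvec_addEquiv (mW_pos n)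
  exact ⟨⟨e⟩, ⟨e.trans f⟩⟩
end
end
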